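/- arXiv:1406.5385 — 3 statements merged into one kernel-verified Lean document; each statement's English description precedes it below -/
import Mathlib

section
/- Let n ≥ 2 and let p : ℝⁿ → ℝ be measurable with 2 ≤ p_- ≤ p_+ < ∞. If the Hardy–Littlewood maximal operator is locally bounded in L^{p(·)}(ℝⁿ), i.e. for every bounded open set Ω ⊂ ℝⁿ there is C > 0 such that ‖Mf‖_{L^{p(·)}(Ω)} ≤ C‖f‖_{L^{p(·)}(Ω)} for all f ∈ L^{p(·)}(Ω), then C_0^∞(ℝⁿ) is dense in W^{1,p(·)}(ℝⁿ): for every f ∈ W^{1,p(·)}(ℝⁿ) and every ε > 0 there exists a smooth compactly supported g : ℝⁿ → ℝ with ‖f − g‖_{1,p(·)} < ε. -/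
open MeasureTheory ENNReal Filter Topology

noncomputable section

abbrev Euc (n : ℕ) : Type := EuclideanSpace ℝ (Fin n)

/-- The modular `ρ_{p(·)}(f) = ∫ |f(x)|^{p(x)} dx` of variable exponent Lebesgue spaces. -/
def varModular (n : ℕ) (p f : Euc n → ℝ) : ℝ≥0∞ :=
  ∫⁻ x, ENNReal.ofReal (|f x| ^ p x)

/-- The Luxemburg norm `‖f‖_{p(·)} = inf {c > 0 : ρ_{p(·)}(f/c) ≤ 1}`. -/
def varNorm (n : ℕ) (p f : Euc n → ℝ) : ℝ :=
  sInf {c : ℝ | 0 < c ∧ varModular n p (fun x => f x / c) ≤ 1}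

/-- Membership in the variable exponent Lebesgue space `L^{p(·)}(ℝⁿ)`. -/
def MemVarLp (n : ℕ) (p f : Euc n → ℝ) : Prop :=
  AEMeasurable f volume ∧ varModular n p f < ⊤

/-- `g` is the `i`-th distributional partial derivative of `f`. -/
def IsWeakDeriv (n : ℕ) (i : Fin n) (f g : Euc n → ℝ) : Prop :=
  LocallyIntegrable f volume ∧ LocallyIntegrable g volume ∧
  ∀ φ : Euc n → ℝ, ContDiff ℝ (⊤ : ℕ∞) φ → HasCompactSupport φ →
    ∫ x, f x * fderiv ℝ φ x (EuclideanSpace.single i 1) = - ∫ x, g x * φ x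

/-- `C_0^∞(ℝⁿ)` is dense in `W^{1,p(·)}(ℝⁿ)`: every Sobolev function `f`, together with its
weak partial derivatives `Df i`, can be approximated in the norm
`‖·‖_{1,p(·)} = ‖·‖_{p(·)} + ∑ ‖D_i ·‖_{p(·)}` by smooth compactly supported functions. -/
def DenseSmooth (n : ℕ) (p : Euc n → ℝ) : Prop :=
  ∀ (f : Euc n → ℝ) (Df : Fin n → Euc n → ℝ),
    MemVarLp n p f →
    (∀ i, IsWeakDeriv n i f (Df i) ∧ MemVarLp n p (Df i)) →
    ∀ ε : ℝ, 0 < ε →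
      ∃ g : Euc n → ℝ, ContDiff ℝ (⊤ : ℕ∞) g ∧ HasCompactSupport g ∧
        varNorm n p (fun x => f x - g x) +
          ∑ i : Fin n, varNorm n p
            (fun x => Df i x - fderiv ℝ g x (EuclideanSpace.single i 1)) < ε

/-- The axis-parallel cube with center `c` and half side length `r`. -/
def cube (n : ℕ) (c : Euc n) (r : ℝ) : Set (Euc n) := {y | ∀ j, |y j - c j| ≤ r}

/-- The Hardy–Littlewood maximal function over axis-parallel cubes containing `x`. -/
def maximalFn (n : ℕ) (f : Euc n → ℝ) (x : Euc n) : ℝ :=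
  sSup {a : ℝ | ∃ (c : Euc n) (r : ℝ), 0 < r ∧ x ∈ cube n c r ∧
    a = (volume (cube n c r)).toReal⁻¹ * ∫ y in cube n c r, |f y|}

/-- The modular of the variable exponent Lebesgue space `L^{p(·)}(Ω)`. -/
def varModularOn (n : ℕ) (p : Euc n → ℝ) (Ω : Set (Euc n)) (f : Euc n → ℝ) : ℝ≥0∞ :=
  ∫⁻ x in Ω, ENNReal.ofReal (|f x| ^ p x)

/-- The Luxemburg norm of `L^{p(·)}(Ω)`. -/
def varNormOn (n : ℕ) (p : Euc n → ℝ) (Ω : Set (Euc n)) (f : Euc n → ℝ) : ℝ :=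
  sInf {c : ℝ | 0 < c ∧ varModularOn n p Ω (fun x => f x / c) ≤ 1}

/-- Membership in the variable exponent Lebesgue space `L^{p(·)}(Ω)`. -/
def MemVarLpOn (n : ℕ) (p : Euc n → ℝ) (Ω : Set (Euc n)) (f : Euc n → ℝ) : Prop :=
  AEMeasurable f (volume.restrict Ω) ∧ varModularOn n p Ω f < ⊤

section Modular

variable {α : Type*} [MeasurableSpace α] {μ : Measure α} {p : α → ℝ}

/-- The modular of a variable exponent Lebesgue space for extended nonnegative functions. -/
def emod (μ : Measure α) (p : α → ℝ) (F : α → ℝ≥0∞) : ℝ≥0∞ := ∫⁻ x, F x ^ p x ∂μ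

lemma emod_enorm (hp : ∀ᵐ x ∂μ, 1 ≤ p x) (f : α → ℝ) :
    ∫⁻ x, ENNReal.ofReal (|f x| ^ p x) ∂μ = emod μ p (fun x => ‖f x‖ₑ) := by
  refine lintegral_congr_ae ?_
  filter_upwards [hp] with x hx
  rw [Real.enorm_eq_ofReal_abs, ENNReal.ofReal_rpow_of_nonneg (abs_nonneg _) (by linarith)]

lemma emod_mono (hp : ∀ᵐ x ∂μ, 1 ≤ p x) {F G : α → ℝ≥0∞} (h : ∀ᵐ x ∂μ, F x ≤ G x) :
    emod μ p F ≤ emod μ p G := by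
  refine lintegral_mono_ae ?_
  filter_upwards [hp, h] with x hx h
  exact ENNReal.rpow_le_rpow h (by linarith)

lemma emod_const_mul_ne_top {P : ℝ} (hp : ∀ᵐ x ∂μ, 1 ≤ p x) (hP : ∀ᵐ x ∂μ, p x ≤ P)
    {F : α → ℝ≥0∞} (hF : emod μ p F ≠ ⊤) {c : ℝ≥0∞} (hc : c ≠ ⊤) :
    emod μ p (fun x => c * F x) ≠ ⊤ := by
  set d := max 1 c with hd
  have hdtop : d ≠ ⊤ := by simp [hd, hc]
  have : emod μ p (fun x => c * F x) ≤ ∫⁻ x, d ^ |P| * F x ^ p x ∂μ := by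
    refine lintegral_mono_ae ?_
    filter_upwards [hp, hP] with x hx hx'
    rw [ENNReal.mul_rpow_of_nonneg _ _ (by linarith)]
    gcongr
    calc c ^ p x ≤ d ^ p x := ENNReal.rpow_le_rpow (le_max_right _ _) (by linarith)
      _ ≤ d ^ |P| := ENNReal.rpow_le_rpow_of_exponent_le (le_max_left _ _)
          (hx'.trans (le_abs_self _))
  refine ne_top_of_le_ne_top ?_ this
  rw [lintegral_const_mul' _ _ (ENNReal.rpow_ne_top_of_nonneg (abs_nonneg _) hdtop)]
  exact ENNReal.mul_ne_top (ENNReal.rpow_ne_top_of_nonneg (abs_nonneg _) hdtop) hF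

lemma add_rpow_le_two_mul (a b : ℝ≥0∞) {q : ℝ} (hq : 0 ≤ q) :
    (a + b) ^ q ≤ (2 * a) ^ q + (2 * b) ^ q := by
  rcases le_total a b with h | h
  · refine le_trans (ENNReal.rpow_le_rpow ?_ hq) le_add_self
    rw [two_mul]; gcongr
  · refine le_trans (ENNReal.rpow_le_rpow ?_ hq) le_self_add
    rw [two_mul]; gcongr

lemma emod_add_le (hpm : AEMeasurable p μ) (hp : ∀ᵐ x ∂μ, 1 ≤ p x) {F G : α → ℝ≥0∞}
    (hF : AEMeasurable F μ) :
    emod μ p (fun x => F x + G x) ≤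
      emod μ p (fun x => 2 * F x) + emod μ p (fun x => 2 * G x) := by
  unfold emod
  rw [← lintegral_add_left' ((hF.const_mul 2).pow hpm)]
  refine lintegral_mono_ae ?_
  filter_upwards [hp] with x hx
  exact add_rpow_le_two_mul _ _ (by linarith)

lemma emod_mul_le {c : ℝ≥0∞} (hc : c ≤ 1) (hp : ∀ᵐ x ∂μ, 1 ≤ p x) (F : α → ℝ≥0∞) :
    emod μ p (fun x => c * F x) ≤ c * emod μ p F := by
  unfold emod
  rw [← lintegral_const_mul' _ _ (ne_top_of_le_ne_top ENNReal.one_ne_top hc)]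
  refine lintegral_mono_ae ?_
  filter_upwards [hp] with x hx
  rw [ENNReal.mul_rpow_of_nonneg _ _ (by linarith)]
  gcongr
  simpa using ENNReal.rpow_le_rpow_of_exponent_ge hc hx

lemma exists_emod_mul_le_one (hp : ∀ᵐ x ∂μ, 1 ≤ p x) {F : α → ℝ≥0∞} (hF : emod μ p F ≠ ⊤) :
    ∃ c : ℝ, 0 < c ∧ emod μ p (fun x => ENNReal.ofReal c⁻¹ * F x) ≤ 1 := by
  obtain ⟨m, hm0, hm⟩ : ∃ m : ℝ, 0 ≤ m ∧ emod μ p F = ENNReal.ofReal m :=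
    ⟨_, ENNReal.toReal_nonneg, (ENNReal.ofReal_toReal hF).symm⟩
  have h1 : (0 : ℝ) < max 1 m := by positivity
  refine ⟨max 1 m, h1, ?_⟩
  refine (emod_mul_le ?_ hp F).trans ?_
  · rw [ENNReal.ofReal_le_one]
    exact inv_le_one_of_one_le₀ (le_max_left _ _)
  · rw [hm, ← ENNReal.ofReal_mul (by positivity), ENNReal.ofReal_le_one]
    rw [inv_mul_le_one₀ h1]
    exact (le_max_right _ _)

/-- Dominated convergence for modulars. -/
lemma tendsto_emod_zero (hpm : AEMeasurable p μ) (hp : ∀ᵐ x ∂μ, 1 ≤ p x) {F : ℕ → α → ℝ≥0∞}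
    (G : α → ℝ≥0∞) (hF : ∀ j, AEMeasurable (F j) μ) (hFG : ∀ j, ∀ᵐ x ∂μ, F j x ≤ G x)
    (hG : emod μ p G ≠ ⊤) (hlim : ∀ᵐ x ∂μ, Tendsto (fun j => F j x) atTop (𝓝 0)) :
    Tendsto (fun j => emod μ p (F j)) atTop (𝓝 0) := by
  have := tendsto_lintegral_of_dominated_convergence' (μ := μ) (F := fun j x => F j x ^ p x)
    (f := fun _ => 0) (fun x => G x ^ p x) (fun j => (hF j).pow hpm) ?_ hG ?_
  · simpa [emod] using this
  · intro j
    filter_upwards [hFG j, hp] with x hx h1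
    exact ENNReal.rpow_le_rpow hx (by linarith)
  · filter_upwards [hlim, hp] with x hx h1
    have := (ENNReal.continuous_rpow_const (y := p x)).continuousAt.tendsto.comp hx
    simpa [Function.comp_def, ENNReal.zero_rpow_of_pos (show 0 < p x by linarith)] using this

/-- Monotone convergence for modulars. -/
lemma emod_iSup_le (hpm : AEMeasurable p μ) (hp : ∀ᵐ x ∂μ, 1 ≤ p x) {F : ℕ → α → ℝ≥0∞}
    (hF : ∀ j, AEMeasurable (F j) μ) (hmono : ∀ x, Monotone fun j => F j x) {b : ℝ≥0∞}
    (hb : ∀ j, emod μ p (F j) ≤ b) : emod μ p (fun x => ⨆ j, F j x) ≤ b := by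
  have := lintegral_tendsto_of_tendsto_of_monotone (μ := μ) (f := fun j x => F j x ^ p x)
    (F := fun x => (⨆ j, F j x) ^ p x) (fun j => (hF j).pow hpm) ?_ ?_
  · exact le_of_tendsto' this hb
  · filter_upwards [hp] with x h1 i j hij
    exact ENNReal.rpow_le_rpow (hmono x hij) (by linarith)
  · filter_upwards with x
    exact (ENNReal.continuous_rpow_const (y := p x)).continuousAt.tendsto.comp
      (tendsto_atTop_iSup (hmono x))

end Modular

section MaximalFunction

variable {n : ℕ}

lemma closedBall_subset_cube (c : Euc n) (r : ℝ) : Metric.closedBall c r ⊆ cube n c r := by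
  intro y hy j
  rw [mem_closedBall_iff_norm] at hy
  exact (by simpa using PiLp.norm_apply_le (y - c) j : |y j - c j| ≤ ‖y - c‖).trans hy

lemma cube_subset_closedBall (c : Euc n) {r : ℝ} (hr : 0 ≤ r) :
    cube n c r ⊆ Metric.closedBall c (n * r) := by
  intro y hy
  rw [mem_closedBall_iff_norm, EuclideanSpace.norm_eq]
  refine Real.sqrt_le_iff.2 ⟨by positivity, ?_⟩
  calc ∑ i, ‖(y - c) i‖ ^ 2 ≤ ∑ i : Fin n, r ^ 2 := by
        gcongr with i
        simpa using hy i
    _ = n * r ^ 2 := by simp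
    _ ≤ (n * r) ^ 2 := by
        rw [mul_pow]
        gcongr
        exact_mod_cast Nat.le_self_pow two_ne_zero n

lemma measurableSet_cube (c : Euc n) (r : ℝ) : MeasurableSet (cube n c r) := by
  have : cube n c r = ⋂ j, {y : Euc n | |y j - c j| ≤ r} := by ext; simp [cube]
  rw [this]
  exact MeasurableSet.iInter fun j => measurableSet_le (by fun_prop) measurable_const

lemma volume_cube_lt_top (c : Euc n) {r : ℝ} (hr : 0 ≤ r) : volume (cube n c r) < ⊤ :=
  (measure_mono (cube_subset_closedBall c hr)).trans_lt measure_closedBall_lt_top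

lemma volume_cube_pos (c : Euc n) {r : ℝ} (hr : 0 < r) : 0 < (volume (cube n c r)).toReal :=
  ENNReal.toReal_pos
    ((Metric.measure_closedBall_pos volume c hr).trans_le
      (measure_mono (closedBall_subset_cube c r))).ne' (volume_cube_lt_top c hr.le).ne

lemma volume_cube_le (c : Euc n) {r : ℝ} (hr : 0 ≤ r) :
    (volume (cube n c (2 * r))).toReal ≤
      (n * 2) ^ n * volume.real (Metric.closedBall (0 : Euc n) r) := by
  have h := measure_mono (μ := volume) (cube_subset_closedBall c (r := 2 * r) (by positivity))
  rw [← mul_assoc, Measure.addHaar_closedBall_mul _ _ (by positivity) hr] at h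
  have h2 := ENNReal.toReal_mono (ENNReal.mul_ne_top ENNReal.ofReal_ne_top
    measure_closedBall_lt_top.ne) h
  rwa [ENNReal.toReal_mul, ENNReal.toReal_ofReal (by positivity), finrank_euclideanSpace_fin]
    at h2

variable {f : Euc n → ℝ} {k : ℝ}

lemma integrableOn_cube (hf : AEMeasurable f volume) (hk : ∀ y, |f y| ≤ k)
    (c : Euc n) {r : ℝ} (hr : 0 ≤ r) : IntegrableOn f (cube n c r) :=
  Measure.integrableOn_of_bounded (volume_cube_lt_top c hr).ne hf.aestronglyMeasurable
    (ae_of_all _ hk)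

lemma cube_average_le (hf : AEMeasurable f volume) (hk : ∀ y, |f y| ≤ k)
    (c : Euc n) {r : ℝ} (hr : 0 < r) :
    (volume (cube n c r)).toReal⁻¹ * ∫ y in cube n c r, |f y| ≤ k := by
  have h : ∫ y in cube n c r, |f y| ≤ ∫ y in cube n c r, k := by
    refine integral_mono (integrableOn_cube hf hk c hr.le).abs ?_ hk
    exact integrableOn_const (volume_cube_lt_top c hr.le).ne
  rw [setIntegral_const, smul_eq_mul] at h
  rw [inv_mul_le_iff₀ (volume_cube_pos c hr)]
  exact h

lemma maximalFn_nonneg (x : Euc n) : 0 ≤ maximalFn n f x := by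
  refine Real.sSup_nonneg ?_
  rintro a ⟨c, r, -, -, rfl⟩
  positivity

lemma maximalFn_le (hf : AEMeasurable f volume) (hk : ∀ y, |f y| ≤ k) (x : Euc n) :
    maximalFn n f x ≤ k := by
  refine Real.sSup_le ?_ ((abs_nonneg _).trans (hk 0))
  rintro a ⟨c, r, hr, -, rfl⟩
  exact cube_average_le hf hk c hr

lemma cube_average_le_maximalFn (hf : AEMeasurable f volume) (hk : ∀ y, |f y| ≤ k) (x : Euc n)
    {r : ℝ} (hr : 0 < r) :
    (volume (cube n x r)).toReal⁻¹ * ∫ y in cube n x r, |f y| ≤ maximalFn n f x := by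
  refine le_csSup ⟨k, ?_⟩ ⟨x, r, hr, fun j => by simpa using hr.le, rfl⟩
  rintro a ⟨c, r, hr, -, rfl⟩
  exact cube_average_le hf hk c hr

/-- Mollifications are pointwise controlled by the maximal function. -/
lemma lintegral_mollifier_le (hf : AEMeasurable f volume) (hk : ∀ y, |f y| ≤ k) (x : Euc n)
    (φ : ContDiffBump (0 : Euc n)) (hφ : φ.rOut = 2 * φ.rIn) :
    ∫⁻ y, ENNReal.ofReal (φ.normed volume (x - y)) * ‖f y‖ₑ ≤
      ENNReal.ofReal ((n * 2) ^ n) * ENNReal.ofReal (maximalFn n f x) := by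
  set Q := cube n x φ.rOut with hQ
  set V := volume.real (Metric.closedBall (0 : Euc n) φ.rIn) with hV
  have hVpos : 0 < V := ENNReal.toReal_pos (Metric.measure_closedBall_pos volume _ φ.rIn_pos).ne'
    measure_closedBall_lt_top.ne
  have hi := integrableOn_cube hf hk x φ.rOut_pos.le
  calc ∫⁻ y, ENNReal.ofReal (φ.normed volume (x - y)) * ‖f y‖ₑ
      ≤ ∫⁻ y, Q.indicator (fun y => ENNReal.ofReal (1 / V) * ‖f y‖ₑ) y := by
        refine lintegral_mono fun y => ?_
        by_cases hy : y ∈ Q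
        · simp only [Set.indicator_of_mem hy]
          gcongr
          exact φ.normed_le_div_measure_closedBall_rIn volume _
        · have : φ.normed volume (x - y) = 0 := by
            by_contra h
            have h2 : x - y ∈ Function.support (φ.normed volume) := h
            rw [φ.support_normed_eq, mem_ball_zero_iff, norm_sub_rev] at h2
            exact hy (closedBall_subset_cube _ _ (mem_closedBall_iff_norm.2 h2.le))
          simp [this]
    _ = ENNReal.ofReal (1 / V) * ENNReal.ofReal (∫ y in Q, |f y|) := by
        rw [lintegral_indicator (measurableSet_cube _ _),
          lintegral_const_mul' _ _ ENNReal.ofReal_ne_top]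
        congr 1
        exact (ofReal_integral_norm_eq_lintegral_enorm hi).symm
    _ = ENNReal.ofReal (1 / V * ∫ y in Q, |f y|) := by rw [ENNReal.ofReal_mul (by positivity)]
    _ ≤ ENNReal.ofReal ((n * 2) ^ n * maximalFn n f x) := by
        refine ENNReal.ofReal_le_ofReal ?_
        refine le_trans ?_ (mul_le_mul_of_nonneg_left
          (cube_average_le_maximalFn hf hk x φ.rOut_pos) (by positivity))
        rw [← mul_assoc]
        refine mul_le_mul_of_nonneg_right ?_ (by positivity)
        rw [← div_eq_mul_inv, div_le_div_iff₀ hVpos (volume_cube_pos x φ.rOut_pos), one_mul]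
        have := volume_cube_le x φ.rIn_pos.le
        rwa [← hφ] at this
    _ = _ := ENNReal.ofReal_mul (by positivity)

end MaximalFunction

section Mollification

variable {n : ℕ} {p : Euc n → ℝ}

lemma enorm_div_eq (a : ℝ) {c : ℝ} (hc : 0 < c) : ‖a / c‖ₑ = ENNReal.ofReal c⁻¹ * ‖a‖ₑ := by
  rw [Real.enorm_eq_ofReal_abs, Real.enorm_eq_ofReal_abs, ← ENNReal.ofReal_mul (by positivity),
    abs_div, abs_of_pos hc, div_eq_inv_mul]

lemma varModular_div_eq (hp : ∀ᵐ x ∂(volume : Measure (Euc n)), 1 ≤ p x) (f : Euc n → ℝ) {c : ℝ}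
    (hc : 0 < c) :
    varModular n p (fun x => f x / c) =
      emod volume p (fun x => ENNReal.ofReal c⁻¹ * ‖f x‖ₑ) := by
  simp_rw [← enorm_div_eq _ hc]
  exact emod_enorm hp _

lemma varModularOn_div_eq {Ω : Set (Euc n)} (hp : ∀ᵐ x ∂(volume.restrict Ω), 1 ≤ p x)
    (f : Euc n → ℝ) {c : ℝ} (hc : 0 < c) :
    varModularOn n p Ω (fun x => f x / c) =
      emod (volume.restrict Ω) p (fun x => ENNReal.ofReal c⁻¹ * ‖f x‖ₑ) := by
  simp_rw [← enorm_div_eq _ hc]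
  exact emod_enorm hp _

lemma emod_restrict_le (Ω : Set (Euc n)) (F : Euc n → ℝ≥0∞) :
    emod (volume.restrict Ω) p F ≤ emod volume p F := setLIntegral_le_lintegral _ _

lemma emod_const_ne_top {α : Type*} [MeasurableSpace α] {μ : Measure α} [IsFiniteMeasure μ]
    {p : α → ℝ} {P : ℝ} (hp : ∀ᵐ x ∂μ, 1 ≤ p x) (hP : ∀ᵐ x ∂μ, p x ≤ P) {c : ℝ≥0∞}
    (hc : c ≠ ⊤) : emod μ p (fun _ => c) ≠ ⊤ := by
  have : emod μ p (fun _ => c * 1) ≠ ⊤ :=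
    emod_const_mul_ne_top hp hP (F := fun _ => 1) (by simp [emod]) hc
  simpa using this

lemma continuous_ofReal_normed (φ : ContDiffBump (0 : Euc n)) :
    Continuous fun z => ENNReal.ofReal (φ.normed volume z) :=
  ENNReal.continuous_ofReal.comp φ.continuous_normed

lemma aemeasurable_mollifier {v : Euc n → ℝ} (hv : AEMeasurable v volume)
    (φ : ContDiffBump (0 : Euc n)) :
    AEMeasurable (fun x => ∫⁻ y, ENNReal.ofReal (φ.normed volume (x - y)) * ‖v y‖ₑ) volume := by
  refine AEMeasurable.lintegral_prod_right'
    (f := fun z : Euc n × Euc n => ENNReal.ofReal (φ.normed volume (z.1 - z.2)) * ‖v z.2‖ₑ) ?_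
  have h1 : Continuous fun z : Euc n × Euc n => ENNReal.ofReal (φ.normed volume (z.1 - z.2)) :=
    (continuous_ofReal_normed φ).comp (by fun_prop : Continuous fun z : Euc n × Euc n => z.1 - z.2)
  have h2 : AEMeasurable (fun z : Euc n × Euc n => ‖v z.2‖ₑ) (volume.prod volume) :=
    (hv.comp_quasiMeasurePreserving Measure.quasiMeasurePreserving_snd).enorm
  exact h1.aemeasurable.mul h2

/-- Modular form of the maximal inequality for a bounded function. -/
lemma emod_maximalFn_le {P : ℝ} {Ω : Set (Euc n)} (hΩ : volume Ω < ⊤)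
    (hp : ∀ᵐ x ∂(volume : Measure (Euc n)), 1 ≤ p x)
    (hP : ∀ᵐ x ∂(volume : Measure (Euc n)), p x ≤ P) {C : ℝ} (hC : 0 < C)
    (hmax : ∀ f : Euc n → ℝ, MemVarLpOn n p Ω f → (∀ x ∉ Ω, f x = 0) →
        varNormOn n p Ω (maximalFn n f) ≤ C * varNormOn n p Ω f)
    {w : Euc n → ℝ} (hw : AEMeasurable w volume) {k : ℝ} (hk : ∀ y, |w y| ≤ k)
    (hw0 : ∀ x ∉ Ω, w x = 0) {c : ℝ} (hc : 0 < c)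
    (hwc : emod volume p (fun x => ENNReal.ofReal c⁻¹ * ‖w x‖ₑ) ≤ 1) :
    emod (volume.restrict Ω) p
      (fun x => ENNReal.ofReal (C * c + 1)⁻¹ * ENNReal.ofReal (maximalFn n w x)) ≤ 1 := by
  have : IsFiniteMeasure (volume.restrict Ω) := ⟨by simpa using hΩ⟩
  have hp' := ae_restrict_of_ae (s := Ω) hp
  have hP' := ae_restrict_of_ae (s := Ω) hP
  have hcset : varModularOn n p Ω (fun x => w x / c) ≤ 1 := by
    rw [varModularOn_div_eq hp' _ hc]
    exact (emod_restrict_le _ _).trans hwc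
  have hnorm : varNormOn n p Ω w ≤ c := csInf_le ⟨0, fun _ h => h.1.le⟩ ⟨hc, hcset⟩
  have hmem : MemVarLpOn n p Ω w := by
    refine ⟨hw.restrict, ?_⟩
    rw [varModularOn, emod_enorm hp', lt_top_iff_ne_top]
    refine ne_top_of_le_ne_top (emod_const_ne_top hp' hP' (c := ENNReal.ofReal k)
      ENNReal.ofReal_ne_top) (emod_mono hp' (ae_of_all _ fun x => ?_))
    rw [Real.enorm_eq_ofReal_abs]
    exact ENNReal.ofReal_le_ofReal (hk x)
  have henorm : ∀ x, ‖maximalFn n w x‖ₑ = ENNReal.ofReal (maximalFn n w x) := fun x => by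
    rw [Real.enorm_eq_ofReal_abs, abs_of_nonneg (maximalFn_nonneg x)]
  have hfin : emod (volume.restrict Ω) p (fun x => ‖maximalFn n w x‖ₑ) ≠ ⊤ := by
    refine ne_top_of_le_ne_top (emod_const_ne_top hp' hP' (c := ENNReal.ofReal k)
      ENNReal.ofReal_ne_top) (emod_mono hp' (ae_of_all _ fun x => ?_))
    rw [henorm]
    exact ENNReal.ofReal_le_ofReal (maximalFn_le hw hk x)
  obtain ⟨d, hd, hd1⟩ := exists_emod_mul_le_one hp' hfin
  have hlt : varNormOn n p Ω (maximalFn n w) < C * c + 1 :=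
    (hmax w hmem hw0).trans_lt (by nlinarith)
  have hne : {c : ℝ | 0 < c ∧ varModularOn n p Ω (fun x => maximalFn n w x / c) ≤ 1}.Nonempty :=
    ⟨d, hd, by rw [varModularOn_div_eq hp' _ hd]; exact hd1⟩
  obtain ⟨e, ⟨he, he1⟩, hlt⟩ := exists_lt_of_csInf_lt hne hlt
  rw [varModularOn_div_eq hp' _ he] at he1
  refine (emod_mono hp' (ae_of_all _ fun x => ?_)).trans he1
  rw [henorm]
  gcongr

/-- If the maximal operator is bounded on `Ω`, then the maximal mollification of a function
supported in `Ω` has finite modular. -/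
lemma emod_iSup_mollifier_ne_top {P : ℝ} {Ω : Set (Euc n)} (hΩ : volume Ω < ⊤) (hpm : Measurable p)
    (hp : ∀ᵐ x ∂(volume : Measure (Euc n)), 1 ≤ p x)
    (hP : ∀ᵐ x ∂(volume : Measure (Euc n)), p x ≤ P) {C : ℝ} (hC : 0 < C)
    (hmax : ∀ f : Euc n → ℝ, MemVarLpOn n p Ω f → (∀ x ∉ Ω, f x = 0) →
        varNormOn n p Ω (maximalFn n f) ≤ C * varNormOn n p Ω f)
    {u : Euc n → ℝ} (hu : AEMeasurable u volume) (hu0 : ∀ x ∉ Ω, u x = 0)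
    (hufin : emod volume p (fun x => ‖u x‖ₑ) ≠ ⊤)
    (φ : ℕ → ContDiffBump (0 : Euc n)) (hφ : ∀ j, (φ j).rOut = 2 * (φ j).rIn) :
    emod (volume.restrict Ω) p
      (fun x => ⨆ j, ∫⁻ y, ENNReal.ofReal ((φ j).normed volume (x - y)) * ‖u y‖ₑ) ≠ ⊤ := by
  have hp' := ae_restrict_of_ae (s := Ω) hp
  have hP' := ae_restrict_of_ae (s := Ω) hP
  obtain ⟨c, hc, hc1⟩ := exists_emod_mul_le_one hp hufin
  let w : ℕ → Euc n → ℝ := fun k y => min |u y| k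
  have hw0 : ∀ k y, 0 ≤ w k y := fun k y => le_min (abs_nonneg _) (Nat.cast_nonneg _)
  have hwe : ∀ k y, ‖w k y‖ₑ = ENNReal.ofReal (w k y) := fun k y => by
    rw [Real.enorm_eq_ofReal_abs, abs_of_nonneg (hw0 k y)]
  have hwm : ∀ k, AEMeasurable (w k) volume := fun k => by
    have : AEMeasurable (fun y => |u y|) volume := hu.norm
    exact this.min aemeasurable_const
  have hmono : ∀ y, Monotone fun k => ‖w k y‖ₑ := fun y i j hij => by
    simp only [hwe]
    exact ENNReal.ofReal_le_ofReal (min_le_min_left _ (by exact_mod_cast hij))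
  have hsup : ∀ y, ⨆ k, ‖w k y‖ₑ = ‖u y‖ₑ := fun y => by
    refine le_antisymm (iSup_le fun k => ?_) ?_
    · rw [hwe, Real.enorm_eq_ofReal_abs]
      exact ENNReal.ofReal_le_ofReal (min_le_left _ _)
    · obtain ⟨k, hk⟩ := exists_nat_ge |u y|
      refine le_trans (le_of_eq ?_) (le_iSup _ k)
      rw [hwe, Real.enorm_eq_ofReal_abs]
      exact congrArg _ (min_eq_left hk).symm
  set A : ℝ := (n * 2) ^ n + 1 with hA
  have hApos : 0 < A := by positivity
  set L : ℝ := C * c + 1 with hL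
  have hLpos : 0 < L := by positivity
  let S : ℕ → Euc n → ℝ≥0∞ := fun k x =>
    ⨆ j, ∫⁻ y, ENNReal.ofReal ((φ j).normed volume (x - y)) * ‖w k y‖ₑ
  have hSm : ∀ k, AEMeasurable (S k) volume := fun k =>
    AEMeasurable.iSup fun j => aemeasurable_mollifier (hwm k) (φ j)
  have hSmono : ∀ x, Monotone fun k => S k x := fun x k l hkl =>
    iSup_mono fun j => lintegral_mono fun y => by gcongr; exact hmono y hkl
  have hSsup : ∀ x, ⨆ k, S k x =
      ⨆ j, ∫⁻ y, ENNReal.ofReal ((φ j).normed volume (x - y)) * ‖u y‖ₑ := fun x => by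
    simp only [S]
    rw [iSup_comm]
    congr 1
    ext j
    rw [← lintegral_iSup']
    · simp_rw [← ENNReal.mul_iSup, hsup]
    · intro k
      have h1 : Continuous fun y : Euc n => ENNReal.ofReal ((φ j).normed volume (x - y)) :=
        (continuous_ofReal_normed (φ j)).comp (by fun_prop : Continuous fun y : Euc n => x - y)
      exact h1.aemeasurable.mul (hwm k).enorm
    · refine ae_of_all _ fun y k l hkl => ?_
      dsimp only
      gcongr
      exact hmono y hkl
  have hbound : ∀ k, emod (volume.restrict Ω) p
      (fun x => ENNReal.ofReal L⁻¹ * (ENNReal.ofReal A⁻¹ * S k x)) ≤ 1 := fun k => by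
    refine (emod_mono hp' (ae_of_all _ fun x => ?_)).trans
      (emod_maximalFn_le hΩ hp hP hC hmax (hwm k) (k := k) ?_ ?_ hc ?_)
    · gcongr
      calc ENNReal.ofReal A⁻¹ * S k x
          ≤ ENNReal.ofReal A⁻¹ * (ENNReal.ofReal A * ENNReal.ofReal (maximalFn n (w k) x)) := by
            gcongr
            refine iSup_le fun j => (lintegral_mollifier_le (hwm k) (k := k) ?_ x (φ j) (hφ j)).trans ?_
            · intro y
              rw [abs_of_nonneg (hw0 k y)]
              exact min_le_right _ _
            · gcongr
              simp [hA]
        _ = _ := by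
            rw [← mul_assoc, ← ENNReal.ofReal_mul (by positivity), inv_mul_cancel₀ hApos.ne']
            simp
    · intro y
      rw [abs_of_nonneg (hw0 k y)]
      exact min_le_right _ _
    · intro x hx
      simp [w, hu0 x hx]
    · refine (emod_mono hp (ae_of_all _ fun x => ?_)).trans hc1
      gcongr
      rw [← hsup]
      exact le_iSup (fun k => ‖w k x‖ₑ) k
  have hlim := emod_iSup_le hpm.aemeasurable hp'
    (F := fun k x => ENNReal.ofReal L⁻¹ * (ENNReal.ofReal A⁻¹ * S k x))
    (fun k => (((hSm k).const_mul _).const_mul _).restrict)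
    (fun x k l hkl => by dsimp only; gcongr; exact hSmono x hkl) hbound
  simp_rw [← ENNReal.mul_iSup, hSsup] at hlim
  have := emod_const_mul_ne_top hp' hP' (ne_top_of_le_ne_top ENNReal.one_ne_top hlim)
    (c := ENNReal.ofReal A * ENNReal.ofReal L)
    (ENNReal.mul_ne_top ENNReal.ofReal_ne_top ENNReal.ofReal_ne_top)
  convert this using 3 with x
  rw [mul_assoc, ← mul_assoc (ENNReal.ofReal L), ← ENNReal.ofReal_mul hLpos.le,
    mul_inv_cancel₀ hLpos.ne', ENNReal.ofReal_one, one_mul, ← mul_assoc,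
    ← ENNReal.ofReal_mul hApos.le, mul_inv_cancel₀ hApos.ne', ENNReal.ofReal_one, one_mul]

end Mollification

section Approximation

open scoped Convolution

variable {n : ℕ} {p : Euc n → ℝ}

lemma enorm_convolution_le (φ : ContDiffBump (0 : Euc n)) (u : Euc n → ℝ) (x : Euc n) :
    ‖(φ.normed volume ⋆[ContinuousLinearMap.lsmul ℝ ℝ, volume] u) x‖ₑ ≤
      ∫⁻ y, ENNReal.ofReal (φ.normed volume (x - y)) * ‖u y‖ₑ := by
  rw [convolution_lsmul_swap]
  refine (enorm_integral_le_lintegral_enorm _).trans (le_of_eq (lintegral_congr fun y => ?_))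
  rw [smul_eq_mul, enorm_mul, Real.enorm_eq_ofReal_abs, abs_of_nonneg (φ.nonneg_normed _)]

lemma convolution_eq_zero (φ : ContDiffBump (0 : Euc n)) {u : Euc n → ℝ} {R : ℝ}
    (hu : ∀ x, R ≤ ‖x‖ → u x = 0) {x : Euc n} (hx : R + φ.rOut ≤ ‖x‖) :
    (φ.normed volume ⋆[ContinuousLinearMap.lsmul ℝ ℝ, volume] u) x = 0 := by
  rw [convolution_lsmul_swap]
  refine integral_eq_zero_of_ae (ae_of_all _ fun y => ?_)
  by_cases hy : R ≤ ‖y‖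
  · simp [hu y hy]
  · have : φ.normed volume (x - y) = 0 := by
      by_contra h
      have h2 : x - y ∈ Function.support (φ.normed volume) := h
      rw [φ.support_normed_eq, mem_ball_zero_iff] at h2
      have := norm_sub_norm_le x y
      linarith
    simp [this]

lemma emod_restrict_eq (hp : ∀ᵐ x ∂(volume : Measure (Euc n)), 1 ≤ p x) {Ω : Set (Euc n)}
    (hΩ : MeasurableSet Ω) {F : Euc n → ℝ≥0∞} (hF : ∀ x ∉ Ω, F x = 0) :
    emod volume p F = emod (volume.restrict Ω) p F := by
  unfold emod
  rw [← lintegral_indicator hΩ]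
  refine lintegral_congr_ae ?_
  filter_upwards [hp] with x hx
  by_cases h : x ∈ Ω
  · simp [h]
  · simp [h, hF x h, ENNReal.zero_rpow_of_pos (show 0 < p x by linarith)]

/-- Mollifications of a compactly supported function converge in modular. -/
lemma tendsto_emod_mollify {P : ℝ} (hpm : Measurable p)
    (hp : ∀ᵐ x ∂(volume : Measure (Euc n)), 1 ≤ p x)
    (hP : ∀ᵐ x ∂(volume : Measure (Euc n)), p x ≤ P)
    (hmax : ∀ Ω : Set (Euc n), IsOpen Ω → Bornology.IsBounded Ω →
      ∃ C : ℝ, 0 < C ∧ ∀ f : Euc n → ℝ, MemVarLpOn n p Ω f → (∀ x ∉ Ω, f x = 0) →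
        varNormOn n p Ω (maximalFn n f) ≤ C * varNormOn n p Ω f)
    {u : Euc n → ℝ} (hu : LocallyIntegrable u volume) {R : ℝ} (hu0 : ∀ x, R ≤ ‖x‖ → u x = 0)
    (hufin : emod volume p (fun x => ‖u x‖ₑ) ≠ ⊤)
    (φ : ℕ → ContDiffBump (0 : Euc n)) (hφ : ∀ j, (φ j).rOut = 2 * (φ j).rIn)
    (hφ1 : ∀ j, (φ j).rOut ≤ 1) (hφ0 : Tendsto (fun j => (φ j).rOut) atTop (𝓝 0))
    {a : ℝ≥0∞} (ha : a ≠ ⊤) :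
    Tendsto (fun j => emod volume p (fun x => a * ‖u x -
      ((φ j).normed volume ⋆[ContinuousLinearMap.lsmul ℝ ℝ, volume] u) x‖ₑ)) atTop (𝓝 0) := by
  set Ω : Set (Euc n) := Metric.ball 0 (R + 1) with hΩdef
  have hΩ : ∀ x ∉ Ω, R + 1 ≤ ‖x‖ := fun x hx => by simpa [hΩdef] using hx
  have hum : AEMeasurable u volume := hu.aestronglyMeasurable.aemeasurable
  obtain ⟨C, hC, hmax⟩ := hmax Ω Metric.isOpen_ball Metric.isBounded_ball
  have hS := emod_iSup_mollifier_ne_top (Ω := Ω) measure_ball_lt_top hpm hp hP hC hmax hum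
    (fun x hx => hu0 x (by linarith [hΩ x hx])) hufin φ hφ
  have hp' := ae_restrict_of_ae (s := Ω) hp
  have hP' := ae_restrict_of_ae (s := Ω) hP
  have hcont : ∀ j, Continuous
      ((φ j).normed volume ⋆[ContinuousLinearMap.lsmul ℝ ℝ, volume] u) := fun j =>
    (φ j).hasCompactSupport_normed.continuous_convolution_left _ (φ j).continuous_normed hu
  have hdiff : ∀ j, AEMeasurable (fun x => ‖u x -
      ((φ j).normed volume ⋆[ContinuousLinearMap.lsmul ℝ ℝ, volume] u) x‖ₑ) volume := fun j =>
    (hum.sub (hcont j).aemeasurable).enorm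
  have hrestr : ∀ j, emod volume p (fun x => a * ‖u x -
      ((φ j).normed volume ⋆[ContinuousLinearMap.lsmul ℝ ℝ, volume] u) x‖ₑ) =
      emod (volume.restrict Ω) p (fun x => a * ‖u x -
      ((φ j).normed volume ⋆[ContinuousLinearMap.lsmul ℝ ℝ, volume] u) x‖ₑ) := fun j => by
    refine emod_restrict_eq hp Metric.isOpen_ball.measurableSet fun x hx => ?_
    rw [hu0 x (by linarith [hΩ x hx]),
      convolution_eq_zero (φ j) hu0 (by linarith [hΩ x hx, hφ1 j])]
    simp
  simp_rw [hrestr]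
  refine tendsto_emod_zero hpm.aemeasurable hp' (fun x => a * (‖u x‖ₑ +
    ⨆ j, ∫⁻ y, ENNReal.ofReal ((φ j).normed volume (x - y)) * ‖u y‖ₑ))
    (fun j => ((hdiff j).const_mul _).restrict) ?_ ?_ ?_
  · intro j
    refine ae_of_all _ fun x => ?_
    gcongr
    refine (enorm_sub_le).trans ?_
    gcongr
    exact (enorm_convolution_le _ _ _).trans
      (le_iSup (fun j => ∫⁻ y, ENNReal.ofReal ((φ j).normed volume (x - y)) * ‖u y‖ₑ) j)
  · refine emod_const_mul_ne_top hp' hP' (ne_top_of_le_ne_top ?_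
      (emod_add_le hpm.aemeasurable hp' hum.enorm.restrict)) ha
    refine ENNReal.add_ne_top.2 ⟨?_, emod_const_mul_ne_top hp' hP' hS (by simp)⟩
    exact emod_const_mul_ne_top hp' hP'
      (ne_top_of_le_ne_top hufin (emod_restrict_le _ _)) (by simp)
  · refine ae_restrict_of_ae ?_
    have := ContDiffBump.ae_convolution_tendsto_right_of_locallyIntegrable (μ := volume) (K := 2)
      hφ0 (Eventually.of_forall fun j => (hφ j).le) hu
    filter_upwards [this] with x hx
    have h1 := (hx.const_sub (u x)).enorm
    rw [sub_self, enorm_zero] at h1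
    simpa using ENNReal.Tendsto.const_mul h1 (Or.inr ha)

/-- Cutoffs converge in modular. -/
lemma tendsto_emod_cutoff {P : ℝ} (hpm : Measurable p)
    (hp : ∀ᵐ x ∂(volume : Measure (Euc n)), 1 ≤ p x)
    (hP : ∀ᵐ x ∂(volume : Measure (Euc n)), p x ≤ P)
    {f h : Euc n → ℝ} (hf : AEMeasurable f volume) (hh : AEMeasurable h volume)
    (hffin : emod volume p (fun x => ‖f x‖ₑ) ≠ ⊤) (hhfin : emod volume p (fun x => ‖h x‖ₑ) ≠ ⊤)
    {s b : ℕ → Euc n → ℝ} (hs : ∀ m, Continuous (s m)) (hb : ∀ m, Continuous (b m))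
    (hs0 : ∀ m x, 0 ≤ s m x) (hs1 : ∀ m x, s m x ≤ 1) {K : ℝ} (hbK : ∀ m x, |b m x| ≤ K)
    (hlim : ∀ x, ∀ᶠ m in atTop, s m x = 1 ∧ b m x = 0) {a : ℝ≥0∞} (ha : a ≠ ⊤) :
    (∀ m, emod volume p (fun x => ‖s m x * h x + b m x * f x‖ₑ) ≠ ⊤) ∧
    Tendsto (fun m => emod volume p (fun x => a * ‖h x - (s m x * h x + b m x * f x)‖ₑ))
      atTop (𝓝 0) := by
  have hG : emod volume p (fun x => ‖h x‖ₑ + ENNReal.ofReal K * ‖f x‖ₑ) ≠ ⊤ := by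
    refine ne_top_of_le_ne_top ?_ (emod_add_le hpm.aemeasurable hp hh.enorm)
    refine ENNReal.add_ne_top.2 ⟨emod_const_mul_ne_top hp hP hhfin (by simp), ?_⟩
    exact emod_const_mul_ne_top hp hP
      (emod_const_mul_ne_top hp hP hffin ENNReal.ofReal_ne_top) (by simp)
  have hbe : ∀ m x, ‖b m x * f x‖ₑ ≤ ENNReal.ofReal K * ‖f x‖ₑ := fun m x => by
    rw [enorm_mul]
    gcongr
    rw [Real.enorm_eq_ofReal_abs]
    exact ENNReal.ofReal_le_ofReal (hbK m x)
  have hle : ∀ {t : ℝ} (x : Euc n), |t| ≤ 1 → ‖t * h x‖ₑ ≤ ‖h x‖ₑ := fun x ht => by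
    rw [enorm_mul]
    refine mul_le_of_le_one_left' ?_
    rw [Real.enorm_eq_ofReal_abs]
    exact ENNReal.ofReal_le_one.2 ht
  refine ⟨fun m => ne_top_of_le_ne_top hG (emod_mono hp (ae_of_all _ fun x => ?_)), ?_⟩
  · refine (enorm_add_le _ _).trans (add_le_add (hle x ?_) (hbe m x))
    rw [abs_of_nonneg (hs0 m x)]
    exact hs1 m x
  refine tendsto_emod_zero hpm.aemeasurable hp
    (fun x => a * (‖h x‖ₑ + ENNReal.ofReal K * ‖f x‖ₑ)) (fun m => ?_) (fun m => ?_)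
    (emod_const_mul_ne_top hp hP hG ha) ?_
  · exact ((hh.sub (((hs m).aemeasurable.mul hh).add
      ((hb m).aemeasurable.mul hf))).enorm).const_mul _
  · refine ae_of_all _ fun x => ?_
    gcongr
    have : h x - (s m x * h x + b m x * f x) = (1 - s m x) * h x - b m x * f x := by ring
    rw [this]
    refine enorm_sub_le.trans (add_le_add (hle x ?_) (hbe m x))
    rw [abs_le]
    constructor <;> linarith [hs0 m x, hs1 m x]
  · refine ae_of_all _ fun x => tendsto_const_nhds.congr' ?_
    filter_upwards [hlim x] with m hm
    simp [hm.1, hm.2]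

end Approximation

section WeakDerivative

open scoped Convolution

variable {n : ℕ}

lemma locallyIntegrable_continuous_mul {f s : Euc n → ℝ} (hf : LocallyIntegrable f volume)
    (hs : Continuous s) : LocallyIntegrable (fun x => s x * f x) volume := by
  rw [locallyIntegrable_iff] at hf ⊢
  exact fun k hk => (hf k hk).continuousOn_mul hs.continuousOn hk

lemma continuous_partialDeriv {s : Euc n → ℝ} (hs : ContDiff ℝ (⊤ : ℕ∞) s) (v : Euc n) :
    Continuous fun x => fderiv ℝ s x v :=
  (hs.continuous_fderiv (by simp)).clm_apply continuous_const

/-- Leibniz rule for the weak derivative of a product with a smooth function. -/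
lemma IsWeakDeriv.smooth_mul {i : Fin n} {f g s : Euc n → ℝ} (h : IsWeakDeriv n i f g)
    (hs : ContDiff ℝ (⊤ : ℕ∞) s) :
    IsWeakDeriv n i (fun x => s x * f x)
      (fun x => s x * g x + fderiv ℝ s x (EuclideanSpace.single i 1) * f x) := by
  obtain ⟨hf, hg, hw⟩ := h
  have hds := continuous_partialDeriv hs (EuclideanSpace.single i 1)
  refine ⟨locallyIntegrable_continuous_mul hf hs.continuous,
    (locallyIntegrable_continuous_mul hg hs.continuous).add
      (locallyIntegrable_continuous_mul hf hds), fun φ hφ hφc => ?_⟩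
  have hdφ := continuous_partialDeriv hφ (EuclideanSpace.single i 1)
  have hder : ∀ x, fderiv ℝ (fun x => s x * φ x) x (EuclideanSpace.single i 1) =
      s x * fderiv ℝ φ x (EuclideanSpace.single i 1) +
        φ x * fderiv ℝ s x (EuclideanSpace.single i 1) := fun x => by
    rw [fderiv_fun_mul (hs.differentiable (by simp) x) (hφ.differentiable (by simp) x)]
    simp
  have key := hw (fun x => s x * φ x) (hs.mul hφ) hφc.mul_left
  simp_rw [hder] at key
  have i1 : Integrable (fun x => f x * (s x * fderiv ℝ φ x (EuclideanSpace.single i 1))) volume :=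
    hf.integrable_smul_right_of_hasCompactSupport (hs.continuous.mul hdφ)
      (hφc.fderiv_apply _ _).mul_left
  have i2 : Integrable (fun x => f x * (φ x * fderiv ℝ s x (EuclideanSpace.single i 1))) volume :=
    hf.integrable_smul_right_of_hasCompactSupport (hφ.continuous.mul hds) hφc.mul_right
  have i3 : Integrable (fun x => g x * (s x * φ x)) volume :=
    hg.integrable_smul_right_of_hasCompactSupport (hs.continuous.mul hφ.continuous) hφc.mul_left
  have e1 : ∫ x, f x * (s x * fderiv ℝ φ x (EuclideanSpace.single i 1) +
      φ x * fderiv ℝ s x (EuclideanSpace.single i 1)) =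
      (∫ x, f x * (s x * fderiv ℝ φ x (EuclideanSpace.single i 1))) +
      ∫ x, f x * (φ x * fderiv ℝ s x (EuclideanSpace.single i 1)) := by
    rw [← integral_add i1 i2]
    simp_rw [mul_add]
  have e2 : ∫ x, (s x * g x + fderiv ℝ s x (EuclideanSpace.single i 1) * f x) * φ x =
      (∫ x, g x * (s x * φ x)) +
      ∫ x, f x * (φ x * fderiv ℝ s x (EuclideanSpace.single i 1)) := by
    rw [← integral_add i3 i2]
    congr 1
    ext x
    ring
  have e3 : ∫ x, s x * f x * fderiv ℝ φ x (EuclideanSpace.single i 1) =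
      ∫ x, f x * (s x * fderiv ℝ φ x (EuclideanSpace.single i 1)) := by
    congr 1
    ext x
    ring
  rw [e2, e3]
  linarith

/-- Mollification commutes with weak differentiation. -/
lemma IsWeakDeriv.fderiv_convolution {i : Fin n} {u v φ : Euc n → ℝ} (h : IsWeakDeriv n i u v)
    (hφ : ContDiff ℝ (⊤ : ℕ∞) φ) (hφc : HasCompactSupport φ) (x : Euc n) :
    fderiv ℝ (φ ⋆[ContinuousLinearMap.lsmul ℝ ℝ, volume] u) x (EuclideanSpace.single i 1) =
      (φ ⋆[ContinuousLinearMap.lsmul ℝ ℝ, volume] v) x := by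
  obtain ⟨hu, -, hw⟩ := h
  have hφ1 : ContDiff ℝ 1 φ := hφ.of_le (by exact_mod_cast le_top)
  have hint := ((hφc.fderiv ℝ).convolutionExists_left (ContinuousLinearMap.precompL (Euc n)
    (ContinuousLinearMap.lsmul ℝ ℝ)) (hφ.continuous_fderiv (by simp)) hu x).integrable
  rw [(hφc.hasFDerivAt_convolution_left (ContinuousLinearMap.lsmul ℝ ℝ) hφ1 hu x).fderiv,
    convolution_def, ContinuousLinearMap.integral_apply hint, convolution_lsmul_swap]
  simp only [ContinuousLinearMap.precompL_apply, ContinuousLinearMap.lsmul_apply, smul_eq_mul]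
  have hψ : ContDiff ℝ (⊤ : ℕ∞) (fun y => φ (x - y)) := hφ.comp (contDiff_const.sub contDiff_id)
  have hψc : HasCompactSupport (fun y => φ (x - y)) :=
    hφc.comp_homeomorph (Homeomorph.subLeft x)
  have hder : ∀ y, fderiv ℝ (fun y => φ (x - y)) y (EuclideanSpace.single i 1) =
      - fderiv ℝ φ (x - y) (EuclideanSpace.single i 1) := fun y => by
    have h := ((hφ.differentiable (by simp) (x - y)).hasFDerivAt.comp y
      ((hasFDerivAt_id y).const_sub x)).fderiv
    change fderiv ℝ (fun y => φ (x - y)) y = _ at h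
    rw [h]
    simp
  have key := hw _ hψ hψc
  simp_rw [hder, mul_neg, integral_neg, neg_inj] at key
  rw [← integral_sub_left_eq_self _ volume x]
  simp only [_root_.sub_sub_cancel]
  simpa only [mul_comm] using key

end WeakDerivative

lemma varNorm_le {n : ℕ} {p f : Euc n → ℝ} (hp : ∀ᵐ x ∂(volume : Measure (Euc n)), 1 ≤ p x)
    {d : ℝ} (hd : 0 < d) (h : emod volume p (fun x => ENNReal.ofReal d⁻¹ * ‖f x‖ₑ) ≤ 1) :
    varNorm n p f ≤ d :=
  csInf_le ⟨0, fun _ h => h.1.le⟩ ⟨hd, by rwa [varModular_div_eq hp f hd]⟩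

/-- Smooth cutoff functions with uniformly bounded derivatives, increasing to one. -/
lemma exists_cutoff (n : ℕ) : ∃ (s : ℕ → Euc n → ℝ) (K : ℝ), (∀ m, ContDiff ℝ (⊤ : ℕ∞) (s m)) ∧
    (∀ m, ∃ R, ∀ x, R ≤ ‖x‖ → s m x = 0 ∧ fderiv ℝ (s m) x = 0) ∧
    (∀ m x, 0 ≤ s m x) ∧ (∀ m x, s m x ≤ 1) ∧ (∀ m x, ‖fderiv ℝ (s m) x‖ ≤ K) ∧
    ∀ x, ∀ᶠ m in atTop, s m x = 1 ∧ fderiv ℝ (s m) x = 0 := by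
  let η : ContDiffBump (0 : Euc n) := ⟨1, 2, one_pos, one_lt_two⟩
  have hη : ContDiff ℝ (⊤ : ℕ∞) η := η.contDiff
  obtain ⟨K, hK⟩ := (hη.continuous_fderiv (by simp)).bounded_above_of_compact_support
    (η.hasCompactSupport.fderiv ℝ)
  let r : ℕ → ℝ := fun m => ((m : ℝ) + 1)⁻¹
  have hr0 : ∀ m, 0 < r m := fun m => by positivity
  have hr1 : ∀ m, r m ≤ 1 := fun m =>
    inv_le_one_of_one_le₀ (by linarith [(Nat.cast_nonneg m : (0 : ℝ) ≤ m)])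
  have hzero : ∀ m (x : Euc n), 2 / r m + 1 ≤ ‖x‖ → η (r m • x) = 0 := fun m x hx => by
    refine η.zero_of_le_dist ?_
    rw [dist_zero_right, norm_smul, Real.norm_of_nonneg (hr0 m).le, mul_comm]
    rw [← div_le_iff₀ (hr0 m)]
    exact le_trans (by simp [η]) hx
  refine ⟨fun m x => η (r m • x), K, fun m => hη.comp (contDiff_const_smul _), fun m => ?_,
    fun m x => η.nonneg, fun m x => η.le_one, fun m x => ?_, fun x => ?_⟩
  · refine ⟨2 / r m + 2, fun x hx => ⟨hzero m x (by linarith), ?_⟩⟩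
    have : (fun x => η (r m • x)) =ᶠ[𝓝 x] fun _ => 0 := by
      have h : ∀ᶠ y in 𝓝 x, 2 / r m + 1 < ‖y‖ :=
        continuous_norm.continuousAt.eventually (lt_mem_nhds (by linarith))
      filter_upwards [h] with y hy using hzero m y hy.le
    rw [this.fderiv_eq]
    simp
  · rw [fderiv_comp_smul (f := η), norm_smul, Real.norm_of_nonneg (hr0 m).le]
    exact (mul_le_of_le_one_left (norm_nonneg _) (hr1 m)).trans (hK _)
  · obtain ⟨N, hN⟩ := exists_nat_gt ‖x‖
    filter_upwards [eventually_ge_atTop N] with m hm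
    have hNm : ‖x‖ < (m : ℝ) + 1 := hN.trans_le (by
      have : (N : ℝ) ≤ m := by exact_mod_cast hm
      linarith)
    have hone : ∀ y : Euc n, ‖y‖ < (m : ℝ) + 1 → η (r m • y) = 1 := fun y hy => by
      refine η.one_of_mem_closedBall ?_
      rw [mem_closedBall_zero_iff, norm_smul, Real.norm_of_nonneg (hr0 m).le]
      exact (inv_mul_le_one₀ (by positivity)).2 hy.le
    refine ⟨hone x hNm, ?_⟩
    have : (fun x => η (r m • x)) =ᶠ[𝓝 x] fun _ => 1 := by
      have h : ∀ᶠ y in 𝓝 x, ‖y‖ < (m : ℝ) + 1 :=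
        continuous_norm.continuousAt.eventually (gt_mem_nhds hNm)
      filter_upwards [h] with y hy using hone y hy
    rw [this.fderiv_eq]
    simp

lemma emod_triangle_le_one {n : ℕ} {p f g h : Euc n → ℝ} (hpm : Measurable p)
    (hp : ∀ᵐ x ∂(volume : Measure (Euc n)), 1 ≤ p x) {a : ℝ≥0∞}
    (hf : AEMeasurable f volume) (hg : AEMeasurable g volume)
    (h1 : emod volume p (fun x => 2 * a * ‖f x - g x‖ₑ) ≤ 2⁻¹)
    (h2 : emod volume p (fun x => 2 * a * ‖g x - h x‖ₑ) ≤ 2⁻¹) :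
    emod volume p (fun x => a * ‖f x - h x‖ₑ) ≤ 1 := by
  calc emod volume p (fun x => a * ‖f x - h x‖ₑ)
      ≤ emod volume p (fun x => a * ‖f x - g x‖ₑ + a * ‖g x - h x‖ₑ) := by
        refine emod_mono hp (ae_of_all _ fun x => ?_)
        rw [← mul_add]
        gcongr
        rw [← sub_add_sub_cancel (f x) (g x) (h x)]
        exact enorm_add_le _ _
    _ ≤ _ := emod_add_le hpm.aemeasurable hp ((hf.sub hg).enorm.const_mul _)
    _ ≤ 2⁻¹ + 2⁻¹ := by
        simp_rw [← mul_assoc]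
        exact add_le_add h1 h2
    _ = 1 := ENNReal.inv_two_add_inv_two

/-- If `2 ≤ p⁻ ≤ p⁺ < ∞` and the Hardy–Littlewood maximal operator is
locally bounded in `L^{p(·)}(ℝⁿ)` (bounded on `L^{p(·)}(Ω)` for every bounded open `Ω`,
functions on `Ω` being extended by zero), then `C_0^∞(ℝⁿ)` is dense in `W^{1,p(·)}(ℝⁿ)`. -/
theorem density_of_locally_bounded_maximal
    (n : ℕ) (hn : 2 ≤ n) (p : Euc n → ℝ) (hp : Measurable p)
    (hp_lower : ∀ᵐ x ∂(volume : Measure (Euc n)), 2 ≤ p x)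
    (hp_upper : ∃ C : ℝ, ∀ᵐ x ∂(volume : Measure (Euc n)), p x ≤ C)
    (hmax : ∀ Ω : Set (Euc n), IsOpen Ω → Bornology.IsBounded Ω →
      ∃ C : ℝ, 0 < C ∧ ∀ f : Euc n → ℝ, MemVarLpOn n p Ω f → (∀ x ∉ Ω, f x = 0) →
        varNormOn n p Ω (maximalFn n f) ≤ C * varNormOn n p Ω f) :
    DenseSmooth n p := by
  intro f Df hf hDf ε hε
  obtain ⟨P, hP⟩ := hp_upper
  have hp1 : ∀ᵐ x ∂(volume : Measure (Euc n)), 1 ≤ p x := by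
    filter_upwards [hp_lower] with x hx using by linarith
  have hfin : ∀ {u : Euc n → ℝ}, MemVarLp n p u → emod volume p (fun x => ‖u x‖ₑ) ≠ ⊤ :=
    fun {u} hu => by
      rw [← emod_enorm hp1]
      exact hu.2.ne
  obtain ⟨s, K, hs, hsupp, hs0, hs1, hsK, hslim⟩ := exists_cutoff n
  let b : Fin n → ℕ → Euc n → ℝ := fun i m x => fderiv ℝ (s m) x (EuclideanSpace.single i 1)
  have hb : ∀ i m, Continuous (b i m) := fun i m => continuous_partialDeriv (hs m) _
  have hbK : ∀ i m x, |b i m x| ≤ K := fun i m x => by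
    have := (fderiv ℝ (s m) x).le_opNorm (EuclideanSpace.single i 1)
    simp only [PiLp.norm_single, norm_one, mul_one] at this
    exact this.trans (hsK m x)
  set d : ℝ := ε / (n + 2) with hd
  have hdpos : 0 < d := by positivity
  set a : ℝ≥0∞ := ENNReal.ofReal d⁻¹ with ha
  have hatop : 2 * a ≠ ⊤ := ENNReal.mul_ne_top (by simp) ENNReal.ofReal_ne_top
  have hcut_f := tendsto_emod_cutoff hp hp1 hP hf.1 hf.1 (hfin hf) (hfin hf)
    (s := s) (b := fun _ _ => 0) (K := 0) (fun m => (hs m).continuous) (fun m => continuous_const)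
    hs0 hs1 (by simp) (fun x => (hslim x).mono fun m hm => ⟨hm.1, rfl⟩) hatop
  simp only [zero_mul, add_zero] at hcut_f
  have hcut_D := fun i => tendsto_emod_cutoff hp hp1 hP hf.1 (hDf i).2.1 (hfin hf)
    (hfin (hDf i).2) (s := s) (b := b i) (fun m => (hs m).continuous) (hb i)
    hs0 hs1 (hbK i) (fun x => (hslim x).mono fun m hm => ⟨hm.1, by simp [b, hm.2]⟩) hatop
  have hhalf : (0 : ℝ≥0∞) < 2⁻¹ := by simp
  obtain ⟨m, hmf, hmD⟩ := ((hcut_f.2.eventually (gt_mem_nhds hhalf)).and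
    (eventually_all.2 fun i => (hcut_D i).2.eventually (gt_mem_nhds hhalf))).exists
  obtain ⟨R, hR⟩ := hsupp m
  set u : Euc n → ℝ := fun x => s m x * f x with hu
  set v : Fin n → Euc n → ℝ := fun i x => s m x * Df i x + b i m x * f x with hv
  have hweak : ∀ i, IsWeakDeriv n i u (v i) := fun i => (hDf i).1.smooth_mul (hs m)
  have huloc : LocallyIntegrable u volume := (hweak ⟨0, by omega⟩).1
  have hu0 : ∀ x, R ≤ ‖x‖ → u x = 0 := fun x hx => by simp [hu, (hR x hx).1]
  have hv0 : ∀ i x, R ≤ ‖x‖ → v i x = 0 := fun i x hx => by simp [hv, b, (hR x hx).1, (hR x hx).2]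
  let r : ℕ → ℝ := fun j => 1 / ((j : ℝ) + 1) / 2
  have hr : ∀ j, 0 < r j := fun j => by positivity
  let φ : ℕ → ContDiffBump (0 : Euc n) := fun j => ⟨r j, 2 * r j, hr j, by linarith [hr j]⟩
  have hφr : ∀ j, (φ j).rOut = 1 / ((j : ℝ) + 1) := fun j => by simp only [φ, r]; ring
  have hφ1 : ∀ j, (φ j).rOut ≤ 1 := fun j => by
    rw [hφr, div_le_one (by positivity)]
    linarith [(Nat.cast_nonneg j : (0 : ℝ) ≤ j)]
  have hφ0 : Tendsto (fun j => (φ j).rOut) atTop (𝓝 0) := by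
    simp_rw [hφr]
    exact tendsto_one_div_add_atTop_nhds_zero_nat
  have hmol_u := tendsto_emod_mollify hp hp1 hP hmax huloc hu0 (hcut_f.1 m) φ (fun j => rfl)
    hφ1 hφ0 hatop
  have hmol_v := fun i => tendsto_emod_mollify hp hp1 hP hmax (hweak i).2.1 (hv0 i)
    ((hcut_D i).1 m) φ (fun j => rfl) hφ1 hφ0 hatop
  obtain ⟨j, hju, hjv⟩ := ((hmol_u.eventually (gt_mem_nhds hhalf)).and
    (eventually_all.2 fun i => (hmol_v i).eventually (gt_mem_nhds hhalf))).exists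
  have hφc := (φ j).hasCompactSupport_normed (μ := volume)
  have hφs : ContDiff ℝ (⊤ : ℕ∞) ((φ j).normed volume) := (φ j).contDiff_normed
  refine ⟨convolution ((φ j).normed volume) u (ContinuousLinearMap.lsmul ℝ ℝ) volume,
    hφc.contDiff_convolution_left _ hφs huloc,
    hφc.convolution _ (HasCompactSupport.intro (isCompact_closedBall 0 R) fun x hx => hu0 x ?_), ?_⟩
  · simpa using (not_le.1 (by simpa using hx)).le
  have hnorm_f : varNorm n p (fun x => f x -
      convolution ((φ j).normed volume) u (ContinuousLinearMap.lsmul ℝ ℝ) volume x) ≤ d :=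
    varNorm_le hp1 hdpos (emod_triangle_le_one hp hp1 hf.1
      huloc.aestronglyMeasurable.aemeasurable hmf.le hju.le)
  have hnorm_D : ∀ i, varNorm n p (fun x => Df i x -
      fderiv ℝ (convolution ((φ j).normed volume) u (ContinuousLinearMap.lsmul ℝ ℝ) volume) x
        (EuclideanSpace.single i 1)) ≤ d := fun i => by
    simp_rw [(hweak i).fderiv_convolution hφs hφc]
    exact varNorm_le hp1 hdpos (emod_triangle_le_one hp hp1 (hDf i).2.1
      (hweak i).2.1.aestronglyMeasurable.aemeasurable (hmD i).le (hjv i).le)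
  calc _ ≤ d + ∑ _i : Fin n, d := add_le_add hnorm_f (Finset.sum_le_sum fun i _ => hnorm_D i)
    _ = (n + 1) * d := by simp; ring
    _ < (n + 2) * d := by nlinarith
    _ = ε := by rw [hd]; field_simp
end
end

section
/- Let n ≥ 2, fix 1 ≤ i, j ≤ n, let h ∈ L¹(ℝⁿ), let λ > 1, and let g_λ : ℝⁿ → [0,1] be smooth, vanish outside the annulus {1/λ ≤ |y| ≤ 2λ}, and satisfy |∂_j g_λ(y)| ≤ c₁/|y| for all y ≠ 0, for some constant c₁ > 0. Define ω_λ(x) = ∫_{ℝⁿ} g_λ(y) (y_i/|y|^{n − 1/λ²}) h(x − y) dy. Then there exists a constant C > 0, depending only on n and c₁, such that for all x, |∂_j ω_λ(x)| ≤ C ∫_{ℝⁿ} |h(x − y)| |y|^{1/λ² − n} dy. -/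
open MeasureTheory ENNReal Filter Topology

noncomputable section

theorem contDiff_mul_coord_div_norm_rpow {n : ℕ} {g : Euc n → ℝ} (hg : ContDiff ℝ 1 g)
    (hg₀ : g =ᶠ[𝓝 0] 0) (i : Fin n) (a : ℝ) :
    ContDiff ℝ 1 fun y : Euc n => g y * (y i / ‖y‖ ^ a) := by
  rw [contDiff_iff_contDiffAt]
  intro y
  rcases eq_or_ne y 0 with rfl | hy
  · refine (contDiffAt_const (c := (0 : ℝ))).congr_of_eventuallyEq ?_
    filter_upwards [hg₀] with z hz
    simp [hz]
  · have hy' : ‖y‖ ≠ 0 := norm_ne_zero_iff.2 hy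
    have hcoord : ContDiffAt ℝ 1 (fun y : Euc n => y i) y :=
      (EuclideanSpace.proj (𝕜 := ℝ) i).contDiff.contDiffAt
    exact hg.contDiffAt.mul (hcoord.div
      ((contDiffAt_norm ℝ hy).rpow_const_of_ne hy')
      (Real.rpow_pos_of_pos (norm_pos_iff.2 hy) a).ne')

/-- The gradient bound for a cut-off of the kernel `y i / ‖y‖ ^ a`, away from the origin. -/
theorem abs_fderiv_mul_coord_div_norm_rpow_le {n : ℕ} {g : Euc n → ℝ} {y v : Euc n}
    (hg : DifferentiableAt ℝ g y) (hg₁ : |g y| ≤ 1) (hy : y ≠ 0) (hv : ‖v‖ ≤ 1) {c : ℝ}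
    (hgv : |fderiv ℝ g y v| ≤ c / ‖y‖) (i : Fin n) {a : ℝ} (ha : 0 ≤ a) :
    |fderiv ℝ (fun y : Euc n => g y * (y i / ‖y‖ ^ a)) y v| ≤ (c + 1 + a) * ‖y‖ ^ (-a) := by
  have hpos : 0 < ‖y‖ := norm_pos_iff.2 hy
  have hnorm : HasFDerivAt (fun y : Euc n => ‖y‖) (fderiv ℝ (fun y : Euc n => ‖y‖) y) y :=
    ((contDiffAt_norm ℝ hy).differentiableAt one_ne_zero).hasFDerivAt
  have hnv : |fderiv ℝ (fun y : Euc n => ‖y‖) y v| ≤ 1 := by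
    have hle : ‖fderiv ℝ (fun y : Euc n => ‖y‖) y‖ ≤ 1 := by
      simpa using norm_fderiv_le_of_lipschitz ℝ (x₀ := y) (lipschitzWith_one_norm (E := Euc n))
    calc |fderiv ℝ (fun y : Euc n => ‖y‖) y v|
        ≤ ‖fderiv ℝ (fun y : Euc n => ‖y‖) y‖ * ‖v‖ :=
          (fderiv ℝ (fun y : Euc n => ‖y‖) y).le_opNorm v
      _ ≤ 1 := mul_le_one₀ hle (norm_nonneg _) hv
  have hcoord : HasFDerivAt (fun y : Euc n => y i) (EuclideanSpace.proj (𝕜 := ℝ) i) y :=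
    (EuclideanSpace.proj (𝕜 := ℝ) i).hasFDerivAt
  have hfun : (fun y : Euc n => g y * (y i / ‖y‖ ^ a)) =
      fun y => g y * (y i * ‖y‖ ^ (-a)) := by
    ext z
    rw [Real.rpow_neg (norm_nonneg z), div_eq_mul_inv]
  have hder := hg.hasFDerivAt.fun_mul
    (hcoord.fun_mul (hnorm.rpow_const (p := -a) (Or.inl hpos.ne')))
  rw [hfun, hder.fderiv]
  have hyi : |y i| ≤ ‖y‖ := PiLp.norm_apply_le y i
  have hvi : |v i| ≤ 1 := (PiLp.norm_apply_le v i).trans hv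
  set d := fderiv ℝ (fun y : Euc n => ‖y‖) y v
  set e := fderiv ℝ g y v
  set R := ‖y‖ ^ (-a) with hR
  have hR₀ : 0 < R := Real.rpow_pos_of_pos hpos _
  have hR' : ‖y‖ ^ (-a - 1) = R / ‖y‖ := Real.rpow_sub_one hpos.ne' _
  have hval : (g y • (y i • ((-a * ‖y‖ ^ (-a - 1)) • fderiv ℝ (fun y : Euc n => ‖y‖) y) +
      R • EuclideanSpace.proj (𝕜 := ℝ) i) + (y i * R) • fderiv ℝ g y) v =
      (g y * (-a * (y i / ‖y‖) * d + v i) + y i * e) * R := by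
    simp [hR', d, e]
    ring
  refine (congrArg abs hval).trans_le ?_
  rw [abs_mul, abs_of_pos hR₀]
  refine mul_le_mul_of_nonneg_right ?_ hR₀.le
  have hq : |y i / ‖y‖| ≤ 1 := by
    rw [abs_div, abs_norm]
    exact div_le_one_of_le₀ hyi (norm_nonneg _)
  have h₁ : |-a * (y i / ‖y‖) * d| ≤ a := by
    rw [abs_mul, abs_mul, abs_neg, abs_of_nonneg ha, mul_assoc]
    exact mul_le_of_le_one_right ha (mul_le_one₀ hq (abs_nonneg _) hnv)
  have h₂ : |g y * (-a * (y i / ‖y‖) * d + v i)| ≤ a + 1 := by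
    rw [abs_mul]
    exact (mul_le_of_le_one_left (abs_nonneg _) hg₁).trans
      ((abs_add_le _ _).trans (add_le_add h₁ hvi))
  have h₃ : |y i * e| ≤ c := by
    rw [abs_mul]
    calc |y i| * |e| ≤ ‖y‖ * (c / ‖y‖) := mul_le_mul hyi hgv (abs_nonneg _) hpos.le
      _ = c := mul_div_cancel₀ c hpos.ne'
  linarith [abs_add_le (g y * (-a * (y i / ‖y‖) * d + v i)) (y i * e)]

/-- Differentiation under the integral sign for the convolution of a compactly supported `C¹`
kernel with an integrable function, with the resulting bound. -/
theorem ofReal_abs_fderiv_integral_mul_sub_le {n : ℕ} {K h : Euc n → ℝ} (hK : ContDiff ℝ 1 K)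
    (hKc : HasCompactSupport K) (hh : Integrable h) (x v : Euc n) :
    ENNReal.ofReal |fderiv ℝ (fun z => ∫ y, K y * h (z - y)) x v| ≤
      ∫⁻ y, ENNReal.ofReal (|fderiv ℝ K y v| * |h (x - y)|) := by
  let L := ContinuousLinearMap.mul ℝ ℝ
  have hder : HasFDerivAt (fun z => ∫ y, K y * h (z - y)) _ x :=
    hKc.hasFDerivAt_convolution_left L hK hh.locallyIntegrable x
  have hex := (hKc.fderiv ℝ).convolutionExists_left (L.precompL (Euc n) :)
    (hK.continuous_fderiv one_ne_zero) hh.locallyIntegrable x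
  have hval : fderiv ℝ (fun z => ∫ y, K y * h (z - y)) x v =
      ∫ y, fderiv ℝ K y v * h (x - y) := by
    rw [hder.fderiv, convolution_def, ContinuousLinearMap.integral_apply hex]
    rfl
  rw [hval, ← Real.norm_eq_abs, ofReal_norm]
  refine (enorm_integral_le_lintegral_enorm _).trans_eq (lintegral_congr fun y => ?_)
  rw [← ofReal_norm, norm_mul, Real.norm_eq_abs, Real.norm_eq_abs]

/-- For `h ∈ L¹(ℝⁿ)`, `λ > 1` and a smooth cutoff `g_λ : ℝⁿ → [0,1]`
supported in the annulus `{1/λ ≤ |y| ≤ 2λ}` with `|∂_j g_λ(y)| ≤ c₁/|y|`, the function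
`ω_λ(x) = ∫ g_λ(y) (y_i/|y|^{n-1/λ²}) h(x-y) dy` satisfies
`|∂_j ω_λ(x)| ≤ C ∫ |h(x-y)| |y|^{1/λ²-n} dy` where `C > 0` depends only on `n` and `c₁`. -/
theorem deriv_omega_bound
    (n : ℕ) (hn : 2 ≤ n) (c₁ : ℝ) (hc₁ : 0 < c₁) :
    ∃ C : ℝ, 0 < C ∧
      ∀ (i j : Fin n) (h : Euc n → ℝ), Integrable h →
        ∀ lam : ℝ, 1 < lam →
          ∀ g : Euc n → ℝ, ContDiff ℝ (⊤ : ℕ∞) g →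
            (∀ y, g y ∈ Set.Icc (0 : ℝ) 1) →
            (∀ y : Euc n, ¬ (1 / lam ≤ ‖y‖ ∧ ‖y‖ ≤ 2 * lam) → g y = 0) →
            (∀ y : Euc n, y ≠ 0 →
              |fderiv ℝ g y (EuclideanSpace.single j 1)| ≤ c₁ / ‖y‖) →
            ∀ x : Euc n,
              ENNReal.ofReal
                  |fderiv ℝ
                    (fun z => ∫ y, g y * (y i / ‖y‖ ^ ((n : ℝ) - 1 / lam ^ 2)) * h (z - y))
                    x (EuclideanSpace.single j 1)| ≤
                ENNReal.ofReal C *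
                  ∫⁻ y, ENNReal.ofReal (|h (x - y)| * ‖y‖ ^ (1 / lam ^ 2 - (n : ℝ))) := by
  refine ⟨c₁ + 1 + n, by positivity, ?_⟩
  intro i j h hh lam hlam g hg hg₁ hgs hgd x
  have hlam₀ : 0 < lam := zero_lt_one.trans hlam
  set a : ℝ := (n : ℝ) - 1 / lam ^ 2 with ha_def
  have ha : 0 ≤ a := by
    have h₁ : 1 / lam ^ 2 ≤ 1 := div_le_one_of_le₀ (one_le_pow₀ hlam.le) (by positivity)
    have h₂ : (2 : ℝ) ≤ n := mod_cast hn
    linarith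
  have han : a ≤ n := sub_le_self _ (by positivity)
  have hg₀ : g =ᶠ[𝓝 0] 0 := by
    filter_upwards [Metric.ball_mem_nhds (0 : Euc n) (one_div_pos.2 hlam₀)] with y hy
    exact hgs y fun hy' => (mem_ball_zero_iff.1 hy).not_ge hy'.1
  have hg1 : ContDiff ℝ 1 g := hg.of_le (mod_cast le_top)
  have hK := contDiff_mul_coord_div_norm_rpow hg1 hg₀ i a
  have hgc : HasCompactSupport g :=
    HasCompactSupport.intro (isCompact_closedBall (0 : Euc n) (2 * lam)) fun y hy =>
      hgs y fun hy' => hy (mem_closedBall_zero_iff.2 hy'.2)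
  refine (ofReal_abs_fderiv_integral_mul_sub_le hK hgc.mul_right hh x
    (EuclideanSpace.single j 1)).trans ?_
  rw [← lintegral_const_mul' _ _ ENNReal.ofReal_ne_top]
  refine lintegral_mono fun y => ?_
  rw [← ENNReal.ofReal_mul (by positivity)]
  refine ENNReal.ofReal_le_ofReal ?_
  rcases eq_or_ne y 0 with rfl | hy
  · have hz : (fun y : Euc n => g y * (y i / ‖y‖ ^ a)) =ᶠ[𝓝 0] fun _ => 0 := by
      filter_upwards [hg₀] with z hz
      simp [hz]
    rw [hz.fderiv_eq]
    simp only [fderiv_fun_const, Pi.zero_apply, zero_apply, abs_zero, zero_mul]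
    positivity
  · have hbound := abs_fderiv_mul_coord_div_norm_rpow_le
      (hg1.differentiable one_ne_zero y)
      (abs_le.2 ⟨by linarith [(hg₁ y).1], (hg₁ y).2⟩) hy
      (v := EuclideanSpace.single j 1) (by simp) (hgd y hy) i ha
    have hexp : 1 / lam ^ 2 - (n : ℝ) = -a := by rw [ha_def]; ring
    rw [hexp]
    calc _ ≤ (c₁ + 1 + a) * ‖y‖ ^ (-a) * |h (x - y)| := by gcongr
      _ ≤ (c₁ + 1 + n) * ‖y‖ ^ (-a) * |h (x - y)| := by gcongr
      _ = _ := by ring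
end
end

section
/- Let n ≥ 1. Then lim_{λ→∞} ∫_{{x ∈ ℝⁿ : 1/λ < |x| < 2λ}} ( | |x|^{1/λ²} − 1 | / |x|^{n−1} ) dx = 0, where the limit is taken as λ → ∞ through real numbers λ > 1. -/
open MeasureTheory ENNReal Filter Topology

noncomputable section

lemma abs_rpow_sub_one_le {lam r : ℝ} (hlam : 1 ≤ lam) (h₁ : 1 / lam < r) (h₂ : r < 2 * lam) :
    |r ^ (1 / lam ^ 2) - 1| ≤ 2 * (Real.log (2 * lam) / lam ^ 2) := by
  have hlam0 : 0 < lam := by linarith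
  have hr : 0 < r := lt_trans (by positivity) h₁
  have hlog : |Real.log r| ≤ Real.log (2 * lam) := by
    rw [abs_le]
    constructor
    · rw [← Real.log_inv]
      refine Real.log_le_log (by positivity) (le_trans ?_ h₁.le)
      rw [one_div]
      gcongr
      linarith
    · exact Real.log_le_log hr h₂.le
  have hexp : |Real.log r * (1 / lam ^ 2)| ≤ Real.log (2 * lam) / lam ^ 2 := by
    rw [abs_mul, abs_of_nonneg (by positivity : (0 : ℝ) ≤ 1 / lam ^ 2), mul_one_div]
    gcongr
  have hone : Real.log (2 * lam) / lam ^ 2 ≤ 1 := by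
    rw [div_le_one (by positivity)]
    have := Real.log_le_sub_one_of_pos (by positivity : 0 < 2 * lam)
    nlinarith [sq_nonneg (lam - 1)]
  rw [Real.rpow_def_of_pos hr]
  exact (Real.abs_exp_sub_one_le (hexp.trans hone)).trans (by gcongr)

/-- Polar coordinates on an annulus, where the weight `‖x‖ ^ (1 - n)` cancels the Jacobian. -/
lemma setIntegral_annulus_div_norm_rpow {n : ℕ} (hn : 1 ≤ n) (f : ℝ → ℝ) {a b : ℝ} (ha : 0 ≤ a) :
    ∫ x in {x : Euc n | a < ‖x‖ ∧ ‖x‖ < b}, f ‖x‖ / ‖x‖ ^ ((n : ℝ) - 1) =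
      n * volume.real (Metric.ball (0 : Euc n) 1) * ∫ r in Set.Ioo a b, f r := by
  have : Nonempty (Fin n) := Fin.pos_iff_nonempty.mp hn
  have hs : MeasurableSet {x : Euc n | a < ‖x‖ ∧ ‖x‖ < b} :=
    (measurableSet_lt measurable_const measurable_norm).inter
      (measurableSet_lt measurable_norm measurable_const)
  have key := integral_fun_norm_addHaar (volume : Measure (Euc n))
    ((Set.Ioo a b).indicator fun r => f r / r ^ ((n : ℝ) - 1))
  have hsub : Set.Ioo a b ⊆ Set.Ioi 0 := fun r hr => ha.trans_lt hr.1
  have hcongr : ∀ r ∈ Set.Ioi (0 : ℝ), r ^ (n - 1) •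
      (Set.Ioo a b).indicator (fun r => f r / r ^ ((n : ℝ) - 1)) r =
        (Set.Ioo a b).indicator f r := by
    intro r hr
    have hr : 0 < r := hr
    by_cases h : r ∈ Set.Ioo a b
    · have hpow : r ^ ((n : ℝ) - 1) = r ^ (n - 1) := by
        rw [← Real.rpow_natCast, Nat.cast_sub hn, Nat.cast_one]
      rw [Set.indicator_of_mem h, Set.indicator_of_mem h, hpow, smul_eq_mul,
        mul_div_cancel₀ _ (pow_pos hr _).ne']
    · simp [Set.indicator_of_notMem h]
  rw [finrank_euclideanSpace, Fintype.card_fin, setIntegral_congr_fun measurableSet_Ioi hcongr,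
    setIntegral_indicator measurableSet_Ioo, Set.inter_eq_right.mpr hsub, nsmul_eq_mul, smul_eq_mul, ← mul_assoc] at key
  rw [← key, ← integral_indicator hs]
  rfl

/-- The integral of `| |x|^{1/λ²} - 1 | / |x|^{n-1}` over the annulus
`{1/λ < |x| < 2λ}` tends to `0` as `λ → ∞`. -/
theorem annulus_integral_tendsto_zero (n : ℕ) (hn : 1 ≤ n) :
    Tendsto
      (fun lam : ℝ =>
        ∫ x in {x : Euc n | 1 / lam < ‖x‖ ∧ ‖x‖ < 2 * lam},
          |‖x‖ ^ (1 / lam ^ 2) - 1| / ‖x‖ ^ ((n : ℝ) - 1))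
      atTop (nhds 0) := by
  have hradial : Tendsto
      (fun lam : ℝ => ∫ r in Set.Ioo (1 / lam) (2 * lam), |r ^ (1 / lam ^ 2) - 1|)
      atTop (nhds 0) := by
    have hlog : Tendsto (fun lam : ℝ => 8 * (Real.log (2 * lam) / (2 * lam))) atTop (nhds 0) := by
      simpa using ((Real.isLittleO_log_id_atTop.tendsto_div_nhds_zero).comp
        (tendsto_id.const_mul_atTop (two_pos : (0 : ℝ) < 2))).const_mul 8
    refine squeeze_zero_norm' ?_ hlog
    filter_upwards [eventually_ge_atTop 1] with lam hlam
    have hlam0 : 0 < lam := by linarith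
    have hlog0 : 0 ≤ Real.log (2 * lam) := Real.log_nonneg (by linarith)
    have hle : 1 / lam ≤ 2 * lam := by
      rw [div_le_iff₀ hlam0]
      nlinarith
    calc _ ≤ 2 * (Real.log (2 * lam) / lam ^ 2) * volume.real (Set.Ioo (1 / lam) (2 * lam)) :=
          norm_setIntegral_le_of_norm_le_const measure_Ioo_lt_top fun r hr => by
            simpa using abs_rpow_sub_one_le hlam hr.1 hr.2
      _ ≤ 2 * (Real.log (2 * lam) / lam ^ 2) * (2 * lam) := by
          rw [Real.volume_real_Ioo_of_le hle]
          gcongr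
          exact sub_le_self _ (by positivity)
      _ = 8 * (Real.log (2 * lam) / (2 * lam)) := by
          field_simp
          ring
  have hmul := hradial.const_mul (n * volume.real (Metric.ball (0 : Euc n) 1))
  rw [mul_zero] at hmul
  refine hmul.congr' ?_
  filter_upwards [eventually_ge_atTop 0] with lam hlam
  exact (setIntegral_annulus_div_norm_rpow hn (fun r => |r ^ (1 / lam ^ 2) - 1|)
    (one_div_nonneg.mpr hlam)).symm
end
end
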